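/- Let Z = Spec R be an integral affine scheme over k, let E = Spec R[x_1,…,x_n] be the total space of the trivial rank-n vector bundle on Z, and let W ⊆ E be a reduced closed subscheme each of whose irreducible components dominates Z. Let I(𝓔_W) := { f ∈ R[x_1,…,x_n] : f(s) = 0 for every étale morphism U → Z and every section s of E ×_Z U over U whose image is contained in W ×_Z U }. Then I(𝓔_W) equals the ideal I(W) of the reduced closed subscheme W. -/

import Mathlib

/-!
STATEMENT 0 (Proposition `etale nullstellenstaz` of the paper).

Let `Z = Spec R` be an integral affine scheme of finite type over an algebraically closed
field `k` of characteristic zero, and let `E = Spec R[x_1,…,x_n]` be the total space of the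
trivial rank-`n` bundle on `Z`.  A reduced closed subscheme `W ⊆ E`, each of whose irreducible
components dominates `Z`, corresponds to a radical ideal `I ⊆ R[x_1,…,x_n]` each of whose
minimal primes contracts to `(0)` in `R`.  A section of `E` over an étale morphism `U → Z`
is, affine locally, a tuple `s : Fin n → A` for an étale `R`-algebra `A`; its image lies in
`W ×_Z U` iff every `g ∈ I` satisfies `g(s) = 0`.  The proposition states that
`I(𝓔_W) = I(W)`: a polynomial `f` vanishes on all sections of `E` over étale `U → Z`
landing in `W` if and only if `f ∈ I(W)`.
-/

open Algebra in
/-- A finitely presented algebraic extension of domains of characteristic zero is generically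
étale. -/
theorem Algebra.exists_etale_localizationAway_of_isAlgebraic
    (R S : Type*) [CommRing R] [IsDomain R] [CharZero R] [CommRing S] [IsDomain S]
    [Algebra R S] [FaithfulSMul R S] [Algebra.IsAlgebraic R S] [FinitePresentation R S] :
    ∃ g : S, g ≠ 0 ∧ Algebra.Etale R (Localization.Away g) := by
  have : FormallyEtale R (FractionRing S) := by
    let : Algebra (FractionRing R) (FractionRing S) := FractionRing.liftAlgebra R (FractionRing S)
    have : Algebra.IsAlgebraic S (FractionRing S) :=
      (IsFractionRing.comap_isAlgebraic_iff (A := S) (K := FractionRing S)).mpr inferInstance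
    have : Algebra.IsAlgebraic R (FractionRing S) := .trans R S _
    have : Algebra.IsAlgebraic (FractionRing R) (FractionRing S) :=
      IsFractionRing.comap_isAlgebraic_iff.mp ‹Algebra.IsAlgebraic R (FractionRing S)›
    have : CharZero (FractionRing R) := IsFractionRing.charZero_of_isFractionRing R
    have : FormallyEtale R (FractionRing R) := .of_isLocalization (nonZeroDivisors R)
    have : FormallyEtale (FractionRing R) (FractionRing S) := .of_isSeparable _ _
    exact .comp R (FractionRing R) (FractionRing S)
  have : IsEtaleAt R (⊥ : Ideal S) := by
    have : IsFractionRing S (Localization.AtPrime (⊥ : Ideal S)) := by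
      simpa only [IsFractionRing, ← Ideal.primeCompl_bot] using
        (inferInstance : IsLocalization.AtPrime (Localization.AtPrime (⊥ : Ideal S)) (⊥ : Ideal S))
    exact .of_equiv
      ((FractionRing.algEquiv S (Localization.AtPrime (⊥ : Ideal S))).restrictScalars R)
  simpa using exists_etale_of_isEtaleAt (R := R) (⊥ : Ideal S)

/-- A nontrivial algebra of finite type over a field `K` maps to a finite extension of `K`. -/
theorem Algebra.exists_algHom_finite_field.{u} {K : Type*} {T : Type u} [Field K] [CommRing T] [Nontrivial T]
    [Algebra K T] [Algebra.FiniteType K T] :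
    ∃ (L : Type u) (_ : Field L) (_ : Algebra K L) (_ : Module.Finite K L),
      Nonempty (T →ₐ[K] L) := by
  obtain ⟨m, hm⟩ := Ideal.exists_maximal T
  let : Field (T ⧸ m) := Ideal.Quotient.field m
  exact ⟨T ⧸ m, inferInstance, inferInstance, finite_of_finite_type_of_isJacobsonRing K (T ⧸ m),
    ⟨Ideal.Quotient.mkₐ K m⟩⟩

/-- Over a domain `R`, an element outside a prime of a finite type algebra contracting to `0`
remains nonzero in some algebraic extension field of `R`. -/
theorem Ideal.exists_algHom_field_notMem_ker {R B : Type} [CommRing R] [IsDomain R] [CommRing B]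
    [Algebra R B] [Algebra.FiniteType R B] (p : Ideal B) [p.IsPrime]
    (hp : p.comap (algebraMap R B) = ⊥) {f : B} (hf : f ∉ p) :
    ∃ (L : Type) (_ : Field L) (_ : Algebra R L) (φ : B →ₐ[R] L),
      FaithfulSMul R L ∧ Algebra.IsAlgebraic R L ∧ (∀ g ∈ p, φ g = 0) ∧ φ f ≠ 0 := by
  let K := FractionRing R
  let C := Localization.Away (Ideal.Quotient.mk p f)
  have hf0 : Ideal.Quotient.mk p f ≠ 0 := by rwa [ne_eq, Ideal.Quotient.eq_zero_iff_mem]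
  have hle : Submonoid.powers (Ideal.Quotient.mk p f) ≤ nonZeroDivisors (B ⧸ p) :=
    powers_le_nonZeroDivisors_of_noZeroDivisors hf0
  have : IsDomain C := IsLocalization.isDomain_localization hle
  have : FaithfulSMul R (B ⧸ p) := by
    rw [faithfulSMul_iff_algebraMap_injective, injective_iff_map_eq_zero]
    intro r hr
    have : r ∈ p.comap (algebraMap R B) := (Ideal.Quotient.eq_zero_iff_mem (I := p)).mp hr
    simpa [hp] using this
  have : FaithfulSMul (B ⧸ p) C :=
    (faithfulSMul_iff_algebraMap_injective _ _).mpr (IsLocalization.injective C hle)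
  have : FaithfulSMul R C := .trans R (B ⧸ p) C
  have : Algebra.FiniteType (B ⧸ p) C :=
    IsLocalization.finiteType_of_monoid_fg (Submonoid.powers (Ideal.Quotient.mk p f)) C
  have : Algebra.FiniteType R C := .trans (S := B ⧸ p) inferInstance inferInstance
  let : Algebra K (FractionRing C) := FractionRing.liftAlgebra R (FractionRing C)
  have : Nontrivial (TensorProduct R K C) :=
    (Algebra.TensorProduct.lift (Algebra.ofId K (FractionRing C))
      (IsScalarTower.toAlgHom R C (FractionRing C)) fun _ _ ↦ .all _ _).toRingHom.domain_nontrivial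
  obtain ⟨L, _, _, _, ⟨χ⟩⟩ := Algebra.exists_algHom_finite_field (K := K) (T := TensorProduct R K C)
  let : Algebra R L := Algebra.compHom L (algebraMap R K)
  have : IsScalarTower R K L := .of_algebraMap_eq fun _ ↦ rfl
  have : FaithfulSMul K L :=
    (faithfulSMul_iff_algebraMap_injective K L).mpr (algebraMap K L).injective
  have : FaithfulSMul R L := .trans R K L
  have : Algebra.IsAlgebraic K L := Algebra.IsAlgebraic.of_finite K L
  have : Algebra.IsAlgebraic R L :=
    (IsFractionRing.comap_isAlgebraic_iff (A := R) (K := K) (C := L)).mpr inferInstance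
  let ψ : C →ₐ[R] L := (χ.restrictScalars R).comp Algebra.TensorProduct.includeRight
  let ι : (B ⧸ p) →ₐ[R] C := IsScalarTower.toAlgHom R (B ⧸ p) C
  refine ⟨L, inferInstance, inferInstance, (ψ.comp ι).comp (Ideal.Quotient.mkₐ R p),
    inferInstance, inferInstance, fun g hg ↦ ?_, ?_⟩
  · simp [Ideal.Quotient.eq_zero_iff_mem.mpr hg]
  · exact ((IsLocalization.Away.algebraMap_isUnit (S := C) (Ideal.Quotient.mk p f)).map ψ).ne_zero

theorem etale_nullstellensatz
    {k : Type} [Field k] [IsAlgClosed k] [CharZero k]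
    (R : Type) [CommRing R] [IsDomain R] [Algebra k R] [Algebra.FiniteType k R]
    (n : ℕ) (I : Ideal (MvPolynomial (Fin n) R))
    (hrad : I.radical = I)
    (hdom : ∀ p ∈ I.minimalPrimes, ∀ r : R, MvPolynomial.C r ∈ p → r = 0)
    (f : MvPolynomial (Fin n) R) :
    (∀ (A : Type) [CommRing A] [Algebra R A] [Algebra.Etale R A] (s : Fin n → A),
        (∀ g ∈ I, MvPolynomial.aeval s g = 0) → MvPolynomial.aeval s f = 0) ↔
      f ∈ I := by
  refine ⟨fun H ↦ ?_, fun hf A _ _ _ s hs ↦ hs f hf⟩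
  by_contra hf
  rw [← hrad, ← Ideal.sInf_minimalPrimes, Submodule.mem_sInf] at hf
  push Not at hf
  obtain ⟨p : Ideal (MvPolynomial (Fin n) R), hp, hfp⟩ := hf
  have : p.IsPrime := hp.1.1
  obtain ⟨L, _, _, φ, _, _, hφ, hφf⟩ := p.exists_algHom_field_notMem_ker (R := R)
    (eq_bot_iff.mpr fun r hr ↦ hdom p hp r hr) hfp
  have : CharZero R := charZero_of_injective_algebraMap (algebraMap k R).injective
  have : IsNoetherianRing R := Algebra.FiniteType.isNoetherianRing k R
  have : Algebra.FiniteType R φ.range := .of_surjective φ.rangeRestrict φ.rangeRestrict_surjective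
  have : Algebra.FinitePresentation R φ.range := Algebra.FinitePresentation.of_finiteType.mp this
  have : FaithfulSMul R φ.range := .tower_bot R φ.range L
  have : Algebra.IsAlgebraic R φ.range := .tower_bot_of_injective (A := L) Subtype.val_injective
  obtain ⟨g, hg, _⟩ := Algebra.exists_etale_localizationAway_of_isAlgebraic R φ.range
  let ι : φ.range →ₐ[R] Localization.Away g := IsScalarTower.toAlgHom R _ _
  have hι : Function.Injective ι :=
    IsLocalization.injective _ (powers_le_nonZeroDivisors_of_noZeroDivisors hg)
  have key (q : MvPolynomial (Fin n) R) :
      MvPolynomial.aeval (fun i ↦ ι (φ.rangeRestrict (.X i))) q = ι (φ.rangeRestrict q) :=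
    DFunLike.congr_fun (MvPolynomial.aeval_unique (ι.comp φ.rangeRestrict)).symm q
  have hf := H (Localization.Away g) (fun i ↦ ι (φ.rangeRestrict (.X i))) fun q hq ↦ by
    rw [key, show φ.rangeRestrict q = 0 from Subtype.ext (hφ q (hp.1.2 hq)), map_zero]
  rw [key, map_eq_zero_iff ι hι] at hf
  exact hφf (congrArg Subtype.val hf)
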